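/- A pair (I₀,J₀) ∈ ℚ × ℚ occurs as the pair of invariants (I(f), J(f)) of some integral ternary cubic form f if and only if it occurs as the pair of invariants of some Weierstrass cubic over ℤ, i.e., a ternary cubic form of the shape y²z + a₁xyz + a₃yz² − x³ − a₂x²z − a₄xz² − a₆z³ with a₁, a₂, a₃, a₄, a₆ ∈ ℤ. -/

import Mathlib

open MvPolynomial

/-- The action of a 3×3 matrix on ternary forms: `(γ·f)(x,y,z) = f((x,y,z)·γ)`. -/
noncomputable def actGL {R : Type*} [CommRing R] (γ : Matrix (Fin 3) (Fin 3) R)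
    (f : MvPolynomial (Fin 3) R) : MvPolynomial (Fin 3) R :=
  bind₁ (fun j => ∑ i : Fin 3, C (γ i j) * X i) f

/-- The Hessian of a ternary form: the determinant of the matrix of second partials. -/
noncomputable def hess {R : Type*} [CommRing R] (f : MvPolynomial (Fin 3) R) :
    MvPolynomial (Fin 3) R :=
  Matrix.det (Matrix.of fun i j => pderiv i (pderiv j f))

/-- The exponent vectors of the ten monomials of a ternary cubic form. -/
def expo : Fin 10 → Fin 3 → ℕ :=
  ![![3,0,0], ![0,3,0], ![0,0,3], ![2,1,0], ![2,0,1],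
    ![1,2,0], ![0,2,1], ![1,0,2], ![0,1,2], ![1,1,1]]

/-- The ternary cubic form with coefficient vector `c : Fin 10 → R`. -/
noncomputable def cubic {R : Type*} [CommRing R] (c : Fin 10 → R) : MvPolynomial (Fin 3) R :=
  ∑ k : Fin 10, C (c k) * ∏ i : Fin 3, X i ^ expo k i

/-- The coefficient vector of the Weierstrass cubic `x³ + A·x·z² + B·z³ − y²·z`. -/
noncomputable def wcoeffs {R : Type*} [CommRing R] (A B : R) : Fin 10 → R :=
  ![1, 0, B, 0, 0, 0, -1, A, 0, 0]

/-- The generic ternary cubic form, whose coefficients are the 10 indeterminates. -/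
noncomputable def genCubic (R : Type*) [CommRing R] :
    MvPolynomial (Fin 3) (MvPolynomial (Fin 10) R) :=
  cubic (fun k => X k)

/-- `P` and `Q` are the invariants `I` and `J`: they are homogeneous of degrees 4 and 6
in the ten coefficients, they satisfy the identity
`H(H(f)) = 12288·I(f)²·f + 512·J(f)·H(f)` (stated for the generic ternary cubic form,
hence for every ternary cubic form over every commutative `R`-algebra), and they are
normalized so that `x³ + A·x·z² + B·z³ − y²·z` has `I = −3A` and `J = −27B`. -/
def IsInvariantPair (R : Type*) [CommRing R] (P Q : MvPolynomial (Fin 10) R) : Prop :=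
  P.IsHomogeneous 4 ∧ Q.IsHomogeneous 6 ∧
  hess (hess (genCubic R)) =
    12288 * C P ^ 2 * genCubic R + 512 * C Q * hess (genCubic R) ∧
  ∀ A B : R, aeval (wcoeffs A B) P = -3 * A ∧ aeval (wcoeffs A B) Q = -27 * B

/-- The coefficient vector of the Weierstrass cubic
`y²z + a₁xyz + a₃yz² − x³ − a₂x²z − a₄xz² − a₆z³`. -/
noncomputable def wlong (a₁ a₂ a₃ a₄ a₆ : ℤ) : Fin 10 → ℤ :=
  ![-1, 0, -a₆, 0, -a₂, 0, 1, -a₄, a₃, a₁]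

/-- The coefficient a₂ of the Jacobian (Artin, Rodriguez-Villegas, Tate) of a cubic. -/
def jacA2 {R : Type*} [CommRing R] (c : Fin 10 → R) : R :=
  -c 3 * c 8 - c 4 * c 6 - c 5 * c 7

/-- The coefficient a₃ of the Jacobian (Artin, Rodriguez-Villegas, Tate) of a cubic. -/
def jacA3 {R : Type*} [CommRing R] (c : Fin 10 → R) : R :=
  9 * c 0 * c 1 * c 2 - c 0 * c 6 * c 8 - c 1 * c 4 * c 7 - c 2 * c 3 * c 5 - c 3 * c 6 * c 7 -
    c 4 * c 5 * c 8

/-- The coefficient a₄ of the Jacobian (Artin, Rodriguez-Villegas, Tate) of a cubic. -/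
def jacA4 {R : Type*} [CommRing R] (c : Fin 10 → R) : R :=
  -3 * c 0 * c 1 * c 7 * c 8 - 3 * c 0 * c 2 * c 5 * c 6 + c 0 * c 5 * c 8 ^ 2 + c 0 * c 6 ^ 2 *
    c 7 - 3 * c 1 * c 2 * c 3 * c 4 + c 1 * c 3 * c 7 ^ 2 + c 1 * c 4 ^ 2 * c 8 + c 2 * c 3 ^ 2
    * c 6 + c 2 * c 4 * c 5 ^ 2 + c 3 * c 4 * c 6 * c 8 + c 3 * c 5 * c 7 * c 8 + c 4 * c 5 * c
    6 * c 7

/-- The coefficient a₆ of the Jacobian (Artin, Rodriguez-Villegas, Tate) of a cubic. -/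
def jacA6 {R : Type*} [CommRing R] (c : Fin 10 → R) : R :=
  -27 * c 0 ^ 2 * c 1 ^ 2 * c 2 ^ 2 + 9 * c 0 ^ 2 * c 1 * c 2 * c 6 * c 8 - c 0 ^ 2 * c 1 * c 8
    ^ 3 - c 0 ^ 2 * c 2 * c 6 ^ 3 + 9 * c 0 * c 1 ^ 2 * c 2 * c 4 * c 7 - c 0 * c 1 ^ 2 * c 7 ^
    3 + 9 * c 0 * c 1 * c 2 ^ 2 * c 3 * c 5 + 3 * c 0 * c 1 * c 2 * c 3 * c 6 * c 7 - 3 * c 0 *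
    c 1 * c 2 * c 3 * c 8 * c 9 + 3 * c 0 * c 1 * c 2 * c 4 * c 5 * c 8 - 3 * c 0 * c 1 * c 2 *
    c 4 * c 6 * c 9 - 3 * c 0 * c 1 * c 2 * c 5 * c 7 * c 9 + c 0 * c 1 * c 2 * c 9 ^ 3 + 2 * c
    0 * c 1 * c 3 * c 7 * c 8 ^ 2 - c 0 * c 1 * c 4 * c 6 * c 7 * c 8 + c 0 * c 1 * c 4 * c 8 ^
    2 * c 9 + 2 * c 0 * c 1 * c 5 * c 7 ^ 2 * c 8 + c 0 * c 1 * c 6 * c 7 ^ 2 * c 9 - c 0 * c 1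
    * c 7 * c 8 * c 9 ^ 2 - c 0 * c 2 ^ 2 * c 5 ^ 3 - c 0 * c 2 * c 3 * c 5 * c 6 * c 8 + c 0 *
    c 2 * c 3 * c 6 ^ 2 * c 9 + 2 * c 0 * c 2 * c 4 * c 5 * c 6 ^ 2 + 2 * c 0 * c 2 * c 5 ^ 2 *
    c 6 * c 7 + c 0 * c 2 * c 5 ^ 2 * c 8 * c 9 - c 0 * c 2 * c 5 * c 6 * c 9 ^ 2 - c 0 * c 3 *
    c 6 ^ 2 * c 7 * c 8 - c 0 * c 4 * c 5 * c 6 * c 8 ^ 2 - c 0 * c 5 ^ 2 * c 7 * c 8 ^ 2 - c 0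
    * c 5 * c 6 ^ 2 * c 7 ^ 2 + c 0 * c 5 * c 6 * c 7 * c 8 * c 9 - c 1 ^ 2 * c 2 * c 4 ^ 3 - c
    1 * c 2 ^ 2 * c 3 ^ 3 + 2 * c 1 * c 2 * c 3 ^ 2 * c 4 * c 8 + c 1 * c 2 * c 3 ^ 2 * c 7 * c
    9 + 2 * c 1 * c 2 * c 3 * c 4 ^ 2 * c 6 - c 1 * c 2 * c 3 * c 4 * c 5 * c 7 - c 1 * c 2 * c
    3 * c 4 * c 9 ^ 2 + c 1 * c 2 * c 4 ^ 2 * c 5 * c 9 - c 1 * c 3 ^ 2 * c 7 ^ 2 * c 8 - c 1 *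
    c 3 * c 4 ^ 2 * c 8 ^ 2 - c 1 * c 3 * c 4 * c 6 * c 7 ^ 2 + c 1 * c 3 * c 4 * c 7 * c 8 * c
    9 - c 1 * c 4 ^ 2 * c 5 * c 7 * c 8 - c 2 * c 3 ^ 2 * c 4 * c 6 ^ 2 - c 2 * c 3 ^ 2 * c 5 *
    c 6 * c 7 - c 2 * c 3 * c 4 * c 5 ^ 2 * c 8 + c 2 * c 3 * c 4 * c 5 * c 6 * c 9 - c 2 * c 4
    ^ 2 * c 5 ^ 2 * c 6 - c 3 * c 4 * c 5 * c 6 * c 7 * c 8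

/-- The coefficient vector of the Hessian. -/
def hessC {R : Type*} [CommRing R] (c : Fin 10 → R) : Fin 10 → R :=
  ![
  24 * c 0 * c 5 * c 7 - 6 * c 0 * c 9 ^ 2 - 8 * c 3 ^ 2 * c 7 + 8 * c 3 * c 4 * c 9 - 8 * c 4 ^
    2 * c 5,
  24 * c 1 * c 3 * c 8 - 6 * c 1 * c 9 ^ 2 - 8 * c 3 * c 6 ^ 2 - 8 * c 5 ^ 2 * c 8 + 8 * c 5 * c
    6 * c 9,
  24 * c 2 * c 4 * c 6 - 6 * c 2 * c 9 ^ 2 - 8 * c 4 * c 8 ^ 2 - 8 * c 6 * c 7 ^ 2 + 8 * c 7 * c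
    8 * c 9,
  72 * c 0 * c 1 * c 7 + 24 * c 0 * c 5 * c 8 - 24 * c 0 * c 6 * c 9 - 24 * c 1 * c 4 ^ 2 - 8 *
    c 3 ^ 2 * c 8 + 16 * c 3 * c 4 * c 6 - 8 * c 3 * c 5 * c 7 + 2 * c 3 * c 9 ^ 2,
  72 * c 0 * c 2 * c 5 + 24 * c 0 * c 6 * c 7 - 24 * c 0 * c 8 * c 9 - 24 * c 2 * c 3 ^ 2 + 16 *
    c 3 * c 4 * c 8 - 8 * c 4 ^ 2 * c 6 - 8 * c 4 * c 5 * c 7 + 2 * c 4 * c 9 ^ 2,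
  72 * c 0 * c 1 * c 8 - 24 * c 0 * c 6 ^ 2 + 24 * c 1 * c 3 * c 7 - 24 * c 1 * c 4 * c 9 - 8 *
    c 3 * c 5 * c 8 + 16 * c 4 * c 5 * c 6 - 8 * c 5 ^ 2 * c 7 + 2 * c 5 * c 9 ^ 2,
  72 * c 1 * c 2 * c 3 + 24 * c 1 * c 4 * c 8 - 24 * c 1 * c 7 * c 9 - 24 * c 2 * c 5 ^ 2 - 8 *
    c 3 * c 6 * c 8 - 8 * c 4 * c 6 ^ 2 + 16 * c 5 * c 6 * c 7 + 2 * c 6 * c 9 ^ 2,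
  72 * c 0 * c 2 * c 6 - 24 * c 0 * c 8 ^ 2 - 24 * c 2 * c 3 * c 9 + 24 * c 2 * c 4 * c 5 + 16 *
    c 3 * c 7 * c 8 - 8 * c 4 * c 6 * c 7 - 8 * c 5 * c 7 ^ 2 + 2 * c 7 * c 9 ^ 2,
  72 * c 1 * c 2 * c 4 - 24 * c 1 * c 7 ^ 2 + 24 * c 2 * c 3 * c 6 - 24 * c 2 * c 5 * c 9 - 8 *
    c 3 * c 8 ^ 2 - 8 * c 4 * c 6 * c 8 + 16 * c 5 * c 7 * c 8 + 2 * c 8 * c 9 ^ 2,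
  216 * c 0 * c 1 * c 2 - 24 * c 0 * c 6 * c 8 - 24 * c 1 * c 4 * c 7 - 24 * c 2 * c 3 * c 5 +
    24 * c 3 * c 6 * c 7 - 8 * c 3 * c 8 * c 9 + 24 * c 4 * c 5 * c 8 - 8 * c 4 * c 6 * c 9 - 8
    * c 5 * c 7 * c 9 + 2 * c 9 ^ 3]

/-- The invariant `c₄` of a long Weierstrass equation. -/
def wC4 {R : Type*} [CommRing R] (a₁ a₂ a₃ a₄ : R) : R :=
  (a₁ ^ 2 + 4 * a₂) ^ 2 - 24 * (2 * a₄ + a₁ * a₃)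

/-- The invariant `c₆` of a long Weierstrass equation. -/
def wC6 {R : Type*} [CommRing R] (a₁ a₂ a₃ a₄ a₆ : R) : R :=
  -(a₁ ^ 2 + 4 * a₂) ^ 3 + 36 * (a₁ ^ 2 + 4 * a₂) * (2 * a₄ + a₁ * a₃)
    - 216 * (a₃ ^ 2 + 4 * a₆)

/-- The invariant `c₄` of a ternary cubic. -/
def cubC4 {R : Type*} [CommRing R] (c : Fin 10 → R) : R :=
  wC4 (c 9) (jacA2 c) (jacA3 c) (jacA4 c)

/-- The invariant `c₆` of a ternary cubic. -/
def cubC6 {R : Type*} [CommRing R] (c : Fin 10 → R) : R :=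
  wC6 (c 9) (jacA2 c) (jacA3 c) (jacA4 c) (jacA6 c)

theorem cubic_expand {R : Type*} [CommRing R] (c : Fin 10 → R) :
    cubic c = C (c 0) * X 0 ^ 3 + C (c 1) * X 1 ^ 3 + C (c 2) * X 2 ^ 3
      + C (c 3) * (X 0 ^ 2 * X 1) + C (c 4) * (X 0 ^ 2 * X 2) + C (c 5) * (X 0 * X 1 ^ 2)
      + C (c 6) * (X 1 ^ 2 * X 2) + C (c 7) * (X 0 * X 2 ^ 2) + C (c 8) * (X 1 * X 2 ^ 2)
      + C (c 9) * (X 0 * X 1 * X 2) := by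
  simp [cubic, Fin.sum_univ_succ, Fin.prod_univ_succ, expo]
  ring

theorem hess_cubic {R : Type*} [CommRing R] (c : Fin 10 → R) :
    hess (cubic c) = cubic (hessC c) := by
  rw [cubic_expand (hessC c), hess, Matrix.det_fin_three, cubic_expand]
  simp only [Matrix.of_apply, map_add, Derivation.leibniz, Derivation.leibniz_pow, pderiv_C,
    pderiv_X, smul_eq_mul, nsmul_eq_mul]
  simp only [Pi.single_apply, Fin.isValue, Fin.reduceEq, if_true, if_false, hessC, Matrix.cons_val,
    map_add, map_sub, map_mul, map_neg, map_pow, map_ofNat, Derivation.leibniz,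
    Derivation.leibniz_pow, pderiv_C, pderiv_X, smul_eq_mul, nsmul_eq_mul, map_natCast, map_one,
    map_zero, Derivation.map_natCast, Derivation.map_one_eq_zero]
  push_cast
  ring

theorem eval_cubic_x {R : Type*} [CommRing R] (c : Fin 10 → R) :
    eval ![1, 0, 0] (cubic c) = c 0 := by
  rw [cubic_expand]; simp

theorem eval_cubic_y {R : Type*} [CommRing R] (c : Fin 10 → R) :
    eval ![0, 1, 0] (cubic c) = c 1 := by
  rw [cubic_expand]; simp

theorem hh_x {R : Type*} [CommRing R] (c : Fin 10 → R) :
    hessC (hessC c) 0 = 48 * cubC4 c ^ 2 * c 0 + 16 * cubC6 c * hessC c 0 := by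
  simp only [hessC, cubC4, cubC6, wC4, wC6, jacA2, jacA3, jacA4, jacA6, Matrix.cons_val]
  ring

theorem hh_y {R : Type*} [CommRing R] (c : Fin 10 → R) :
    hessC (hessC c) 1 = 48 * cubC4 c ^ 2 * c 1 + 16 * cubC6 c * hessC c 1 := by
  simp only [hessC, cubC4, cubC6, wC4, wC6, jacA2, jacA3, jacA4, jacA6, Matrix.cons_val]
  ring

theorem map_cubC4 {R S : Type*} [CommRing R] [CommRing S] (φ : R →+* S) (c : Fin 10 → R) :
    φ (cubC4 c) = cubC4 (fun k => φ (c k)) := by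
  simp [cubC4, wC4, jacA2, jacA3, jacA4, map_ofNat]

theorem map_cubC6 {R S : Type*} [CommRing R] [CommRing S] (φ : R →+* S) (c : Fin 10 → R) :
    φ (cubC6 c) = cubC6 (fun k => φ (c k)) := by
  simp [cubC6, wC6, jacA2, jacA3, jacA4, jacA6, map_ofNat]

theorem map_hessC0 {R S : Type*} [CommRing R] [CommRing S] (φ : R →+* S) (c : Fin 10 → R) :
    φ (hessC c 0) = hessC (fun k => φ (c k)) 0 := by
  simp [hessC, map_ofNat]

theorem map_hessC1 {R S : Type*} [CommRing R] [CommRing S] (φ : R →+* S) (c : Fin 10 → R) :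
    φ (hessC c 1) = hessC (fun k => φ (c k)) 1 := by
  simp [hessC, map_ofNat]

theorem aeval_rat (v : Fin 10 → ℚ) (p : MvPolynomial (Fin 10) ℚ) : aeval v p = eval v p :=
  DFunLike.congr_fun (coe_aeval_eq_eval v) p

/-- The invariants are determined: `16 I = c₄` and `32 J = c₆`. -/
theorem invariants_eq (P Q : MvPolynomial (Fin 10) ℚ) (hPQ : IsInvariantPair ℚ P Q) :
    16 * P = cubC4 X ∧ 32 * Q = cubC6 X := by
  obtain ⟨-, -, hH, hN⟩ := hPQ
  rw [genCubic, hess_cubic, hess_cubic] at hH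
  have h0 := congrArg (eval ![1, 0, 0]) hH
  have h1 := congrArg (eval ![0, 1, 0]) hH
  simp only [map_add, map_mul, map_pow, eval_cubic_x, eval_cubic_y, eval_C, map_ofNat] at h0 h1
  rw [hh_x] at h0
  rw [hh_y] at h1
  have hX : (fun k => X k : Fin 10 → MvPolynomial (Fin 10) ℚ) = X := rfl
  rw [hX] at h0 h1
  -- a point where the form and its Hessian are independent
  let φ : MvPolynomial (Fin 10) ℚ →+* ℚ := eval (![1, 0, 0, 0, 0, 0, 0, 0, 0, 1] : Fin 10 → ℚ)
  have hφ : ∀ k, φ (X k) = (![1, 0, 0, 0, 0, 0, 0, 0, 0, 1] : Fin 10 → ℚ) k := fun k => by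
    simp [φ]
  have hH0 : hessC (X : Fin 10 → MvPolynomial (Fin 10) ℚ) 0 ≠ 0 := by
    intro h
    have := congrArg φ h
    rw [map_hessC0] at this
    simp only [hφ] at this
    simp [hessC] at this
  let ψ : MvPolynomial (Fin 10) ℚ →+* ℚ := eval (![1, 1, 0, 1, 0, 0, 0, 1, 0, 0] : Fin 10 → ℚ)
  have hψ : ∀ k, ψ (X k) = (![1, 1, 0, 1, 0, 0, 0, 1, 0, 0] : Fin 10 → ℚ) k := fun k => by
    simp [ψ]
  have hD : (X 0 : MvPolynomial (Fin 10) ℚ) * hessC (X : Fin 10 → MvPolynomial (Fin 10) ℚ) 1 - X 1 * hessC (X : Fin 10 → MvPolynomial (Fin 10) ℚ) 0 ≠ 0 := by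
    intro h
    have := congrArg ψ h
    rw [map_sub, map_mul, map_mul, map_hessC0, map_hessC1] at this
    simp only [hψ] at this
    simp [hessC] at this
  have hsq : (16 * P) ^ 2 = cubC4 (X : Fin 10 → MvPolynomial (Fin 10) ℚ) ^ 2 := by
    apply mul_right_cancel₀ hD
    apply mul_left_cancel₀ (show (48 : MvPolynomial (Fin 10) ℚ) ≠ 0 by norm_num)
    linear_combination hessC (X : Fin 10 → MvPolynomial (Fin 10) ℚ) 0 * h1 - hessC (X : Fin 10 → MvPolynomial (Fin 10) ℚ) 1 * h0
  have hQ : 32 * Q = cubC6 (X : Fin 10 → MvPolynomial (Fin 10) ℚ) := by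
    apply mul_right_cancel₀ hH0
    apply mul_left_cancel₀ (show (16 : MvPolynomial (Fin 10) ℚ) ≠ 0 by norm_num)
    linear_combination -h0 - 48 * X 0 * hsq
  refine ⟨?_, hQ⟩
  rcases sq_eq_sq_iff_eq_or_eq_neg.mp hsq with h | h
  · exact h
  · exfalso
    have h2 := congrArg (eval (wcoeffs (1 : ℚ) 0)) h
    rw [map_neg, map_cubC4] at h2
    have h3 := (hN 1 0).1
    rw [aeval_rat] at h3
    rw [map_mul, h3] at h2
    simp [wcoeffs, cubC4, wC4, jacA2, jacA3, jacA4] at h2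
    norm_num at h2

theorem aeval_invariants (P Q : MvPolynomial (Fin 10) ℚ) (hPQ : IsInvariantPair ℚ P Q)
    (c : Fin 10 → ℤ) :
    aeval (fun k => ((c k : ℚ))) P = (cubC4 c : ℤ) / 16 ∧
      aeval (fun k => ((c k : ℚ))) Q = (cubC6 c : ℤ) / 32 := by
  obtain ⟨h1, h2⟩ := invariants_eq P Q hPQ
  have h3 := congrArg (eval (fun k => ((c k : ℚ)))) h1
  have h4 := congrArg (eval (fun k => ((c k : ℚ)))) h2
  rw [map_cubC4] at h3
  rw [map_cubC6] at h4
  have h5 := map_cubC4 (Int.castRingHom ℚ) c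
  have h6 := map_cubC6 (Int.castRingHom ℚ) c
  simp only [eq_intCast] at h5 h6
  rw [h5, h6, aeval_rat, aeval_rat]
  simp at h3 h4
  constructor
  · rw [← h3]; ring
  · rw [← h4]; ring

theorem cubC4_wlong (a₁ a₂ a₃ a₄ a₆ : ℤ) :
    cubC4 (wlong a₁ a₂ a₃ a₄ a₆) = wC4 a₁ a₂ a₃ a₄ := by
  simp [cubC4, wC4, jacA2, jacA3, jacA4, wlong]

theorem cubC6_wlong (a₁ a₂ a₃ a₄ a₆ : ℤ) :
    cubC6 (wlong a₁ a₂ a₃ a₄ a₆) = wC6 a₁ a₂ a₃ a₄ a₆ := by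
  simp [cubC6, wC6, jacA2, jacA3, jacA4, jacA6, wlong]

/-- A pair `(I₀,J₀) ∈ ℚ × ℚ` occurs as the invariants of some integral ternary cubic form
if and only if it occurs as the invariants of some Weierstrass cubic over `ℤ`. -/
theorem stmt14 (P Q : MvPolynomial (Fin 10) ℚ) (hPQ : IsInvariantPair ℚ P Q)
    (I₀ J₀ : ℚ) :
    (∃ c : Fin 10 → ℤ,
        aeval (fun k => ((c k : ℚ))) P = I₀ ∧ aeval (fun k => ((c k : ℚ))) Q = J₀) ↔
      (∃ a₁ a₂ a₃ a₄ a₆ : ℤ,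
        aeval (fun k => ((wlong a₁ a₂ a₃ a₄ a₆ k : ℚ))) P = I₀ ∧
        aeval (fun k => ((wlong a₁ a₂ a₃ a₄ a₆ k : ℚ))) Q = J₀) := by
  constructor
  · rintro ⟨c, h1, h2⟩
    obtain ⟨h3, h4⟩ := aeval_invariants P Q hPQ c
    refine ⟨c 9, jacA2 c, jacA3 c, jacA4 c, jacA6 c, ?_⟩
    obtain ⟨h5, h6⟩ := aeval_invariants P Q hPQ
      (wlong (c 9) (jacA2 c) (jacA3 c) (jacA4 c) (jacA6 c))
    rw [cubC4_wlong] at h5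
    rw [cubC6_wlong] at h6
    exact ⟨h5.trans (h3.symm.trans h1), h6.trans (h4.symm.trans h2)⟩
  · rintro ⟨a₁, a₂, a₃, a₄, a₆, h⟩
    exact ⟨wlong a₁ a₂ a₃ a₄ a₆, h⟩
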